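/- arXiv:1201.3701 — 2 statements merged into one kernel-verified Lean document; each statement's English description precedes it below -/
import Mathlib

section
/- For every natural number n and every real number x, the Bernoulli polynomial admits the moment representation B_n(x) = ∫_{-∞}^{∞} (x - 1/2 + i u)^n · (π/2) sech²(π u) du, where the integral is an absolutely convergent complex-valued integral whose value is the real number B_n(x). -/
open MeasureTheory Real

lemma aux_exp_le_cosh (u : ℝ) : Real.exp |u| ≤ 2 * Real.cosh (π * u) := by
  have h1 : Real.cosh u ≤ Real.cosh (π * u) := by
    rw [Real.cosh_le_cosh, abs_mul, abs_of_pos Real.pi_pos]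
    nlinarith [abs_nonneg u, Real.pi_gt_three]
  have h2 : Real.exp |u| ≤ 2 * Real.cosh u := by
    rw [← Real.cosh_abs, Real.cosh_eq]
    linarith [Real.exp_pos (-|u|)]
  linarith

lemma aux_w_bound (u : ℝ) : (1 / Real.cosh (π * u)) ^ 2 ≤ 4 * Real.exp (-(2 * |u|)) := by
  have h := aux_exp_le_cosh u
  have hc := Real.cosh_pos (π * u)
  have he := Real.exp_pos |u|
  have : 1 / Real.cosh (π * u) ≤ 2 * (Real.exp |u|)⁻¹ := by
    rw [← div_eq_mul_inv, div_le_div_iff₀ hc he]; linarith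
  calc _ ≤ (2 * (Real.exp |u|)⁻¹) ^ 2 := by gcongr
    _ = _ := by
      rw [mul_pow, ← Real.exp_neg, ← Real.exp_nat_mul]; norm_num

lemma aux_pow_le (k : ℕ) (a : ℝ) (ha : 0 ≤ a) : a ^ k ≤ k.factorial * Real.exp a := by
  have := Real.pow_div_factorial_le_exp a ha k
  rw [div_le_iff₀ (by positivity)] at this
  linarith

lemma aux_int (c : ℂ) (k : ℕ) : Integrable (fun u : ℝ =>
      (c + Complex.I * (u : ℂ)) ^ k *
        (((π / 2) * (1 / Real.cosh (π * u)) ^ 2 : ℝ) : ℂ)) := by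
  have hi : Integrable (fun u : ℝ =>
      (k.factorial * Real.exp ‖c‖ * (π / 2) * 8) * (1 + u ^ 2)⁻¹) :=
    integrable_inv_one_add_sq.const_mul _
  refine hi.mono' ?_ ?_
  · apply Continuous.aestronglyMeasurable
    have : ∀ u : ℝ, Real.cosh (π * u) ≠ 0 := fun u => (Real.cosh_pos _).ne'
    have h2 : Continuous fun u : ℝ => (π / 2) * (1 / Real.cosh (π * u)) ^ 2 := by
      have : Continuous fun u : ℝ => 1 / Real.cosh (π * u) :=
        continuous_const.div (Real.continuous_cosh.comp (by fun_prop)) this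
      fun_prop
    have h3 := Complex.continuous_ofReal.comp h2
    exact Continuous.mul (by fun_prop) h3
  · refine Filter.Eventually.of_forall fun u => ?_
    have hpi := Real.pi_pos
    rw [norm_mul, norm_pow, Complex.norm_real, Real.norm_of_nonneg (by positivity)]
    have h1 : ‖c + Complex.I * (u : ℂ)‖ ≤ ‖c‖ + |u| := by
      refine (norm_add_le _ _).trans ?_
      simp
    have h2 : ‖c + Complex.I * (u : ℂ)‖ ^ k ≤ k.factorial * (Real.exp ‖c‖ * Real.exp |u|) := by
      rw [← Real.exp_add]
      exact (pow_le_pow_left₀ (norm_nonneg _) h1 k).trans (aux_pow_le k _ (by positivity))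
    have h3 := aux_w_bound u
    have h4 : Real.exp (-|u|) ≤ 2 * (1 + u ^ 2)⁻¹ := by
      have := Real.quadratic_le_exp_of_nonneg (abs_nonneg u)
      rw [sq_abs] at this
      rw [Real.exp_neg, ← div_eq_mul_inv, inv_eq_one_div, div_le_div_iff₀ (Real.exp_pos _) (by positivity)]
      nlinarith [abs_nonneg u]
    calc _ ≤ (k.factorial * (Real.exp ‖c‖ * Real.exp |u|)) *
            (π / 2 * (4 * Real.exp (-(2 * |u|)))) := by gcongr
      _ = (k.factorial * Real.exp ‖c‖ * (π / 2) * 4) * Real.exp (-|u|) := by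
          have : Real.exp (-|u|) = Real.exp |u| * Real.exp (-(2 * |u|)) := by
            rw [← Real.exp_add]; ring_nf
          rw [this]; ring
      _ ≤ (k.factorial * Real.exp ‖c‖ * (π / 2) * 4) * (2 * (1 + u ^ 2)⁻¹) := by gcongr
      _ = _ := by ring

lemma aux_total : ∫ u : ℝ, (((π / 2) * (1 / Real.cosh (π * u)) ^ 2 : ℝ) : ℂ) = 1 := by
  have hint : Integrable fun u : ℝ => (π / 2) * (1 / Real.cosh (π * u)) ^ 2 := by
    have := (aux_int 0 0).re
    simpa [← Complex.ofReal_mul, ← Complex.ofReal_pow, ← Complex.ofReal_inv,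
      ← Complex.ofReal_div, -Complex.ofReal_cosh] using this
  rw [integral_complex_ofReal]
  have hd : ∀ u : ℝ, HasDerivAt (fun u : ℝ => (1 + Real.exp (-(2 * π * u)))⁻¹)
      ((π / 2) * (1 / Real.cosh (π * u)) ^ 2) u := by
    intro u
    have h0 : HasDerivAt (fun u : ℝ => -(2 * π * u)) (-(2 * π)) u := by
      have h00 := ((hasDerivAt_id u).const_mul (2 * π)).neg
      rw [mul_one] at h00
      exact h00
    have h := (h0.exp.const_add 1).inv (by positivity)
    refine HasDerivAt.congr_deriv (f := fun u : ℝ => (1 + Real.exp (-(2 * π * u)))⁻¹) h ?_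
    rw [Real.cosh_eq]
    have e1 : Real.exp (-(2 * π * u)) = Real.exp (-(π * u)) ^ 2 := by
      rw [← Real.exp_nat_mul]; ring_nf
    have e2 : Real.exp (π * u) = (Real.exp (-(π * u)))⁻¹ := by rw [Real.exp_neg, inv_inv]
    rw [e1, e2]
    have := Real.exp_pos (-(π * u))
    generalize Real.exp (-(π * u)) = y at *
    field_simp
    try ring
  have ht : Filter.Tendsto (fun u : ℝ => 2 * π * u) Filter.atTop Filter.atTop :=
    Filter.tendsto_id.const_mul_atTop (by positivity)
  have hb : Filter.Tendsto (fun u : ℝ => 2 * π * u) Filter.atBot Filter.atBot :=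
    Filter.tendsto_id.const_mul_atBot (by positivity)
  have h1 : Filter.Tendsto (fun u : ℝ => (1 + Real.exp (-(2 * π * u)))⁻¹) Filter.atTop (nhds 1) := by
    have := (Real.tendsto_exp_neg_atTop_nhds_zero.comp ht).const_add 1
    simpa using this.inv₀ (by norm_num)
  have h2 : Filter.Tendsto (fun u : ℝ => (1 + Real.exp (-(2 * π * u)))⁻¹) Filter.atBot (nhds 0) := by
    apply Filter.Tendsto.inv_tendsto_atTop
    apply Filter.tendsto_atTop_add_const_left
    exact Real.tendsto_exp_atTop.comp (Filter.tendsto_neg_atBot_atTop.comp hb)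
  rw [integral_of_hasDerivAt_of_tendsto hd hint h2 h1]
  simp

noncomputable def auxG : ℂ → ℂ := dslope (fun z : ℂ => Complex.sinh (π * z)) 0

lemma auxG_diff : Differentiable ℂ auxG := by
  have h : DifferentiableOn ℂ (fun z : ℂ => Complex.sinh (π * z)) Set.univ := by
    apply Differentiable.differentiableOn; fun_prop
  have := (Complex.differentiableOn_dslope (c := 0) Filter.univ_mem).2 h
  exact differentiableOn_univ.1 this

lemma auxG_of_ne {z : ℂ} (hz : z ≠ 0) : auxG z = Complex.sinh (π * z) / z := by
  rw [auxG, dslope_of_ne _ hz, slope_def_field]; simp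

lemma auxG_zero : auxG 0 = π := by
  rw [auxG, dslope_same]
  have h : HasDerivAt (fun z : ℂ => Complex.sinh (π * z)) (Complex.cosh (π * 0) * (π * 1)) 0 :=
    ((hasDerivAt_id (0 : ℂ)).const_mul (π : ℂ)).csinh
  rw [h.deriv]; simp

lemma aux_normSq_sinh (a b : ℝ) :
    Complex.normSq (Complex.sinh (π * (a + b * Complex.I))) =
      Real.sinh (π * a) ^ 2 + Real.sin (π * b) ^ 2 := by
  have : Complex.sinh (π * (a + b * Complex.I)) =
      ((Real.sinh (π * a) * Real.cos (π * b) : ℝ) : ℂ) +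
      ((Real.cosh (π * a) * Real.sin (π * b) : ℝ) : ℂ) * Complex.I := by
    rw [mul_add, ← mul_assoc, Complex.sinh_add, Complex.sinh_mul_I, Complex.cosh_mul_I]
    push_cast; ring
  rw [this, Complex.normSq_add_mul_I, mul_pow, mul_pow, Real.cosh_sq, Real.cos_sq']
  ring

lemma auxG_ne {z : ℂ} (h1 : -1 < z.im) (h2 : z.im < 1) : auxG z ≠ 0 := by
  by_cases hz : z = 0
  · rw [hz, auxG_zero]; exact_mod_cast Real.pi_ne_zero
  rw [auxG_of_ne hz]
  refine div_ne_zero (fun h => hz ?_) hz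
  have hn := aux_normSq_sinh z.re z.im
  rw [Complex.re_add_im, h, map_zero] at hn
  have ha : Real.sinh (π * z.re) = 0 := by
    nlinarith [sq_nonneg (Real.sinh (π * z.re)), sq_nonneg (Real.sin (π * z.im))]
  have hb : Real.sin (π * z.im) = 0 := by
    nlinarith [sq_nonneg (Real.sinh (π * z.re)), sq_nonneg (Real.sin (π * z.im))]
  have hpi := Real.pi_pos
  rw [Real.sinh_eq_zero] at ha
  rw [Real.sin_eq_zero_iff_of_lt_of_lt (by nlinarith) (by nlinarith)] at hb
  apply Complex.ext
  · simpa [hpi.ne'] using ha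
  · simpa [hpi.ne'] using hb

lemma aux_side (m : ℕ) (T y : ℝ) (hT : 1 ≤ |T|) (hy : |y| ≤ 1 / 2) :
    ‖((T : ℂ) + y * Complex.I) ^ m * (auxG (T + y * Complex.I) ^ 2)⁻¹‖ ≤
      16 * (m + 2).factorial * Real.exp 1 * Real.exp (-|T|) := by
  set z : ℂ := (T : ℂ) + y * Complex.I with hzdef
  have hz : z ≠ 0 := by
    intro h
    have := congrArg Complex.re h
    simp [hzdef] at this
    rw [this] at hT; norm_num at hT
  have hzn : ‖z‖ ≤ |T| + 1 := by
    refine (norm_add_le _ _).trans ?_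
    simp; linarith
  have hs : Real.exp |T| / 4 ≤ Real.sinh |π * T| := by
    have h1 : Real.sinh |T| ≤ Real.sinh |π * T| := by
      rw [Real.sinh_le_sinh, abs_mul, abs_of_pos Real.pi_pos]
      nlinarith [Real.pi_gt_three]
    have h2 : Real.exp (-|T|) ≤ 1 := Real.exp_le_one_iff.2 (by linarith)
    have h3 := Real.add_one_le_exp |T|
    rw [Real.sinh_eq |T|] at h1
    linarith
  have hsn : (Real.exp |T| / 4) ^ 2 ≤ ‖Complex.sinh (π * z)‖ ^ 2 := by
    rw [← Complex.normSq_eq_norm_sq, hzdef, aux_normSq_sinh]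
    have h1 : (Real.exp |T| / 4) ^ 2 ≤ Real.sinh |π * T| ^ 2 := by
      gcongr
    rw [← Real.abs_sinh, sq_abs] at h1
    nlinarith [sq_nonneg (Real.sin (π * y))]
  have heq : z ^ m * (auxG z ^ 2)⁻¹ = z ^ (m + 2) / Complex.sinh (π * z) ^ 2 := by
    rw [auxG_of_ne hz, div_pow, inv_div, pow_add]; ring
  rw [heq, norm_div, norm_pow, norm_pow]
  calc _ ≤ ((m + 2).factorial * Real.exp (|T| + 1)) / (Real.exp |T| / 4) ^ 2 := by
        gcongr
        exact (pow_le_pow_left₀ (norm_nonneg _) hzn _).trans (aux_pow_le _ _ (by positivity))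
    _ = _ := by
        rw [Real.exp_add, Real.exp_neg]
        field_simp
        try norm_num

lemma auxF_bottom (m : ℕ) (u e : ℝ) (he : e ^ 2 = 1) :
    ((u : ℂ) + ((e / 2 : ℝ) : ℂ) * Complex.I) ^ m *
      (auxG (u + ((e / 2 : ℝ) : ℂ) * Complex.I) ^ 2)⁻¹ =
    -(((u : ℂ) + ((e / 2 : ℝ) : ℂ) * Complex.I) ^ (m + 2) *
      ((1 / Real.cosh (π * u)) ^ 2 : ℝ)) := by
  set z : ℂ := (u : ℂ) + ((e / 2 : ℝ) : ℂ) * Complex.I with hzdef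
  have hz : z ≠ 0 := by
    intro h
    have := congrArg Complex.im h
    simp [hzdef] at this
    rw [this] at he; norm_num at he
  have hs : Complex.sinh (π * z) ^ 2 = -(Complex.cosh (π * u)) ^ 2 := by
    rw [hzdef, mul_add, ← mul_assoc, Complex.sinh_add, Complex.sinh_mul_I, Complex.cosh_mul_I,
      ← Complex.ofReal_mul π (e / 2), ← Complex.ofReal_cos, ← Complex.ofReal_sin]
    rcases (by simpa using he : e = 1 ∨ e = -1) with rfl | rfl
    · rw [show π * (1 / 2) = π / 2 by ring]
      simp [mul_pow]
    · rw [show π * (-1 / 2) = -(π / 2) by ring, Real.cos_neg, Real.sin_neg]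
      simp [mul_pow]
  rw [auxG_of_ne hz, div_pow, inv_div, hs, pow_add]
  push_cast
  rw [div_neg]; ring

lemma aux_contour (m : ℕ) :
    ∫ u : ℝ, ((u : ℂ) + ((-1 / 2 : ℝ) : ℂ) * Complex.I) ^ m *
      (auxG (u + ((-1 / 2 : ℝ) : ℂ) * Complex.I) ^ 2)⁻¹ =
    ∫ u : ℝ, ((u : ℂ) + ((1 / 2 : ℝ) : ℂ) * Complex.I) ^ m *
      (auxG (u + ((1 / 2 : ℝ) : ℂ) * Complex.I) ^ 2)⁻¹ := by
  have hint : ∀ e : ℝ, e ^ 2 = 1 → Integrable fun u : ℝ =>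
      ((u : ℂ) + ((e / 2 : ℝ) : ℂ) * Complex.I) ^ m *
      (auxG (u + ((e / 2 : ℝ) : ℂ) * Complex.I) ^ 2)⁻¹ := by
    intro e he
    simp_rw [auxF_bottom m _ e he]
    have h := (aux_int ((-e / 2 : ℝ) : ℂ) (m + 2)).const_mul (-(2 / π * (-Complex.I) ^ (m + 2)))
    refine h.congr (Filter.Eventually.of_forall fun u => ?_)
    have hp : (π : ℂ) ≠ 0 := by exact_mod_cast Real.pi_ne_zero
    have hz : (u : ℂ) + ((e / 2 : ℝ) : ℂ) * Complex.I =
        (-Complex.I) * (((-e / 2 : ℝ) : ℂ) + Complex.I * u) := by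
      push_cast
      linear_combination (u : ℂ) * Complex.I_mul_I
    simp only [hz, mul_pow]
    push_cast
    field_simp
  have hrect : ∀ T : ℝ,
      (∫ u in (-T)..T, ((u : ℂ) + ((-1 / 2 : ℝ) : ℂ) * Complex.I) ^ m *
        (auxG (u + ((-1 / 2 : ℝ) : ℂ) * Complex.I) ^ 2)⁻¹) -
      (∫ u in (-T)..T, ((u : ℂ) + ((1 / 2 : ℝ) : ℂ) * Complex.I) ^ m *
        (auxG (u + ((1 / 2 : ℝ) : ℂ) * Complex.I) ^ 2)⁻¹) +
      Complex.I • (∫ y in (-1 / 2 : ℝ)..(1 / 2), ((T : ℂ) + y * Complex.I) ^ m *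
        (auxG (T + y * Complex.I) ^ 2)⁻¹) -
      Complex.I • (∫ y in (-1 / 2 : ℝ)..(1 / 2), (((-T : ℝ) : ℂ) + y * Complex.I) ^ m *
        (auxG (((-T : ℝ) : ℂ) + y * Complex.I) ^ 2)⁻¹) = 0 := by
    intro T
    have := Complex.integral_boundary_rect_eq_zero_of_differentiableOn
      (fun z => z ^ m * (auxG z ^ 2)⁻¹) ⟨-T, -1 / 2⟩ ⟨T, 1 / 2⟩ ?_
    · exact this
    · intro z hz
      have hz2 := hz.2
      simp only [Set.mem_preimage] at hz2
      rw [Set.uIcc_of_le (by norm_num)] at hz2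
      apply DifferentiableAt.differentiableWithinAt
      have hg : auxG z ≠ 0 := auxG_ne (by linarith [hz2.1]) (by linarith [hz2.2])
      have := auxG_diff z
      exact (by fun_prop : DifferentiableAt ℂ (fun z : ℂ => z ^ m) z).mul
        ((this.pow 2).inv (pow_ne_zero _ hg))
  have hside : ∀ s : ℝ, |s| = 1 → Filter.Tendsto (fun T : ℝ =>
      ∫ y in (-1 / 2 : ℝ)..(1 / 2), (((s * T : ℝ) : ℂ) + y * Complex.I) ^ m *
        (auxG (((s * T : ℝ) : ℂ) + y * Complex.I) ^ 2)⁻¹) Filter.atTop (nhds 0) := by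
    intro s hs
    have hlim : Filter.Tendsto (fun T : ℝ => 16 * (m + 2).factorial * Real.exp 1 * Real.exp (-T))
        Filter.atTop (nhds 0) := by
      simpa using Real.tendsto_exp_neg_atTop_nhds_zero.const_mul
        (16 * ((m + 2).factorial : ℝ) * Real.exp 1)
    refine squeeze_zero_norm' ?_ hlim
    filter_upwards [Filter.eventually_ge_atTop 1] with T hT
    have habs : |s * T| = T := by rw [abs_mul, hs, one_mul, abs_of_nonneg (by linarith)]
    have := intervalIntegral.norm_integral_le_of_norm_le_const (a := (-1 / 2 : ℝ)) (b := 1 / 2)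
      (C := 16 * (m + 2).factorial * Real.exp 1 * Real.exp (-T))
      (f := fun y : ℝ => (((s * T : ℝ) : ℂ) + y * Complex.I) ^ m *
        (auxG (((s * T : ℝ) : ℂ) + y * Complex.I) ^ 2)⁻¹) ?_
    · refine this.trans (le_of_eq ?_)
      norm_num
    · intro y hy
      rw [Set.uIoc_of_le (by norm_num)] at hy
      have := aux_side m (s * T) y (by rw [habs]; exact hT)
        (abs_le.2 ⟨by linarith [hy.1], hy.2⟩)
      rwa [habs] at this
  have t1 := intervalIntegral_tendsto_integral (hint (-1) (by norm_num))
    Filter.tendsto_neg_atTop_atBot Filter.tendsto_id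
  have t2 := intervalIntegral_tendsto_integral (hint 1 (by norm_num))
    Filter.tendsto_neg_atTop_atBot Filter.tendsto_id
  have t3 := (hside 1 (by norm_num)).const_smul Complex.I
  have t4 := (hside (-1) (by norm_num)).const_smul Complex.I
  have t := ((t1.sub t2).add t3).sub t4
  have h0 := tendsto_nhds_unique (t.congr (fun T => by
    have := hrect T
    simpa only [id, one_mul, neg_one_mul] using this)) tendsto_const_nhds
  rw [smul_zero, add_zero, sub_zero] at h0
  exact sub_eq_zero.1 h0

noncomputable def auxM (k : ℕ) : ℂ := ∫ u : ℝ, (-(1 / 2 : ℂ) + Complex.I * (u : ℂ)) ^ k *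
        (((π / 2) * (1 / Real.cosh (π * u)) ^ 2 : ℝ) : ℂ)

lemma aux_shift (m : ℕ) :
    ∫ u : ℝ, ((1 / 2 : ℂ) + Complex.I * (u : ℂ)) ^ (m + 2) *
        (((π / 2) * (1 / Real.cosh (π * u)) ^ 2 : ℝ) : ℂ) = auxM (m + 2) := by
  have h := aux_contour m
  simp_rw [auxF_bottom m _ (-1) (by norm_num), auxF_bottom m _ 1 (by norm_num)] at h
  have key : ∀ e : ℝ, ∫ u : ℝ, (((-e / 2 : ℝ) : ℂ) + Complex.I * (u : ℂ)) ^ (m + 2) *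
        (((π / 2) * (1 / Real.cosh (π * u)) ^ 2 : ℝ) : ℂ) =
      (-(π / 2) * Complex.I ^ (m + 2)) * ∫ u : ℝ, -(((u : ℂ) + ((e / 2 : ℝ) : ℂ) * Complex.I) ^ (m + 2) *
      ((1 / Real.cosh (π * u)) ^ 2 : ℝ)) := by
    intro e
    rw [← integral_const_mul]
    congr 1
    ext u
    have hz : ((-e / 2 : ℝ) : ℂ) + Complex.I * u =
        Complex.I * ((u : ℂ) + ((e / 2 : ℝ) : ℂ) * Complex.I) := by
      push_cast
      linear_combination (-(e : ℂ) / 2) * Complex.I_mul_I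
    rw [hz, mul_pow]
    push_cast
    ring
  have k1 := key (-1)
  have k2 := key 1
  rw [h, ← k2] at k1
  rw [auxM]
  convert k1 using 5
  · push_cast; norm_num
  · push_cast; norm_num

lemma aux_expand (c : ℂ) (n : ℕ) :
    ∫ u : ℝ, (c + (-(1 / 2 : ℂ)) + Complex.I * (u : ℂ)) ^ n *
        (((π / 2) * (1 / Real.cosh (π * u)) ^ 2 : ℝ) : ℂ) =
      ∑ k ∈ Finset.range (n + 1), auxM k * c ^ (n - k) * (n.choose k : ℂ) := by
  have : ∀ u : ℝ, (c + (-(1 / 2 : ℂ)) + Complex.I * (u : ℂ)) ^ n *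
        (((π / 2) * (1 / Real.cosh (π * u)) ^ 2 : ℝ) : ℂ) =
      ∑ k ∈ Finset.range (n + 1), ((-(1 / 2 : ℂ)) + Complex.I * (u : ℂ)) ^ k *
        (((π / 2) * (1 / Real.cosh (π * u)) ^ 2 : ℝ) : ℂ) * (c ^ (n - k) * (n.choose k : ℂ)) := by
    intro u
    rw [add_assoc, add_comm c, add_pow, Finset.sum_mul]
    refine Finset.sum_congr rfl fun k _ => ?_
    ring
  simp_rw [this]
  rw [integral_finsetSum _ (fun k _ => (aux_int _ k).mul_const _)]
  refine Finset.sum_congr rfl fun k _ => ?_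
  rw [integral_mul_const, auxM, mul_assoc]

lemma aux_rec (n : ℕ) : ∑ k ∈ Finset.range n, (n.choose k : ℂ) * auxM k =
    if n = 1 then 1 else 0 := by
  rcases n with _ | _ | m
  · simp
  · simp only [zero_add, Finset.sum_range_one, if_true]
    simp only [auxM, pow_zero, one_mul]
    rw [aux_total]; simp
  · have h := aux_expand 1 (m + 2)
    rw [show (1 : ℂ) + -(1 / 2) = 1 / 2 by norm_num, aux_shift, Finset.sum_range_succ] at h
    simp only [one_pow, mul_one, Nat.choose_self, Nat.cast_one] at h
    have h' := left_eq_add.1 (h.trans (add_comm _ _))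
    rw [if_neg (by omega), ← h']
    exact Finset.sum_congr rfl fun k _ => mul_comm _ _

lemma auxM_eq (n : ℕ) : auxM n = ((bernoulli n : ℚ) : ℂ) := by
  induction n using Nat.strong_induction_on with
  | _ n ih =>
    have h1 := aux_rec (n + 1)
    have h2' : ∑ k ∈ Finset.range (n + 1), ((n + 1).choose k : ℂ) * ((bernoulli k : ℚ) : ℂ) =
        if n + 1 = 1 then 1 else 0 := by
      have h5 := sum_bernoulli (n + 1)
      split_ifs at h5 ⊢ <;> exact_mod_cast congrArg (fun q : ℚ => (q : ℂ)) h5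
    have h3 := h1.trans h2'.symm
    rw [Finset.sum_range_succ, Finset.sum_range_succ,
      Finset.sum_congr rfl (fun k hk => by rw [ih k (Finset.mem_range.1 hk)])] at h3
    have h4 := add_left_cancel h3
    refine mul_left_cancel₀ ?_ h4
    rw [Nat.choose_succ_self_right]
    exact_mod_cast Nat.succ_ne_zero n

/-- Moment representation of the Bernoulli polynomials:
`B_n(x) = ∫ (x - 1/2 + i u)^n (π/2) sech²(π u) du`, the integral being absolutely
convergent and equal to the (real) value `B_n(x)`. -/
theorem statement_2 (n : ℕ) (x : ℝ) :
    Integrable (fun u : ℝ =>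
      ((x : ℂ) - 1 / 2 + Complex.I * (u : ℂ)) ^ n *
        (((π / 2) * (1 / Real.cosh (π * u)) ^ 2 : ℝ) : ℂ)) ∧
    ((Polynomial.aeval x (Polynomial.bernoulli n) : ℝ) : ℂ) =
      ∫ u : ℝ, ((x : ℂ) - 1 / 2 + Complex.I * (u : ℂ)) ^ n *
        (((π / 2) * (1 / Real.cosh (π * u)) ^ 2 : ℝ) : ℂ) := by
  refine ⟨aux_int _ n, ?_⟩
  have h := aux_expand (x : ℂ) n
  simp only [← sub_eq_add_neg] at h
  rw [h, Polynomial.bernoulli, map_sum]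
  push_cast
  refine Finset.sum_congr rfl fun k _ => ?_
  rw [Polynomial.aeval_monomial, auxM_eq]
  simp
  ring
end

section
/- (Cancellation lemma, Bernoulli case) For every natural number n and every real number x, ∫_0^1 ∫_{-∞}^{∞} (x - 1/2 + i u + v)^n · (π/2) sech²(π u) du dv = xⁿ; that is, adding an independent uniform-[0,1] shift to x - 1/2 + i·(logistic variable) reduces every integer moment to xⁿ. -/
open MeasureTheory Real

noncomputable def rho (u : ℝ) : ℝ := (π / 2) * (1 / Real.cosh (π * u)) ^ 2

lemma rho_cont : Continuous rho := by
  unfold rho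
  have : ∀ u : ℝ, Real.cosh (π * u) ≠ 0 := fun u => (Real.cosh_pos _).ne'
  fun_prop (disch := assumption)

lemma rho_nonneg (u : ℝ) : 0 ≤ rho u := by
  unfold rho; positivity

lemma rho_le (u : ℝ) : rho u ≤ 2 * π * Real.exp (-|u|) := by
  have h1 : Real.exp |u| ≤ (2 * Real.cosh (π * u)) ^ 2 := by
    have h2 : Real.exp |u| ≤ 2 * Real.cosh (π * u) := by
      rw [← Real.cosh_abs, Real.cosh_eq, abs_mul, abs_of_pos Real.pi_pos]
      have : Real.exp |u| ≤ Real.exp (π * |u|) := by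
        apply Real.exp_le_exp.mpr
        nlinarith [Real.pi_gt_three, abs_nonneg u]
      have := Real.exp_pos (-(π * |u|))
      linarith
    have h3 : 1 ≤ Real.exp |u| := Real.one_le_exp (abs_nonneg u)
    nlinarith
  have hc := Real.cosh_pos (π * u)
  have he := Real.exp_pos |u|
  unfold rho
  rw [Real.exp_neg, one_div, inv_pow]
  have : ((Real.cosh (π * u)) ^ 2)⁻¹ ≤ 4 * (Real.exp |u|)⁻¹ := by
    rw [← div_eq_mul_inv, inv_eq_one_div, div_le_div_iff₀ (by positivity) he]
    nlinarith
  nlinarith [Real.pi_pos]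

/-- domination -/
lemma abs_int (A : ℝ) (hA : 1 ≤ A) (k : ℕ) : Integrable (fun u : ℝ => (A + |u|) ^ k * rho u) := by
  have hI : Integrable (fun u : ℝ => (2 * π * Real.exp A * (k + 2).factorial) * (1 + u ^ 2)⁻¹) :=
    integrable_inv_one_add_sq.const_mul _
  refine hI.mono' ?_ ?_
  · have := rho_cont
    exact Continuous.aestronglyMeasurable (by fun_prop)
  · refine Filter.Eventually.of_forall fun u => ?_
    have hu := abs_nonneg u
    set g := A + |u| with hg
    have hg0 : 0 < g := by linarith
    have h1 : rho u ≤ 2 * π * Real.exp A * Real.exp (-g) := by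
      refine (rho_le u).trans (le_of_eq ?_)
      rw [mul_assoc (2 * π), ← Real.exp_add]
      congr 2
      rw [hg]; ring
    have h2 := Real.pow_div_factorial_le_exp g hg0.le (k + 2)
    have h3 : g ^ k * Real.exp (-g) ≤ (k + 2).factorial * (1 + u ^ 2)⁻¹ := by
      rw [Real.exp_neg]
      have hf : (0 : ℝ) < (k + 2).factorial := by positivity
      rw [div_le_iff₀ hf] at h2
      rw [← div_eq_mul_inv, ← div_eq_mul_inv, div_le_div_iff₀ (Real.exp_pos _) (by positivity)]
      have h4 : 1 + u ^ 2 ≤ g ^ 2 := by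
        rw [← sq_abs u]; nlinarith
      calc g ^ k * (1 + u ^ 2) ≤ g ^ k * g ^ 2 := by gcongr
        _ = g ^ (k + 2) := by ring
        _ ≤ _ := by linarith
    rw [Real.norm_of_nonneg (mul_nonneg (by positivity) (rho_nonneg u))]
    calc g ^ k * rho u ≤ g ^ k * (2 * π * Real.exp A * Real.exp (-g)) := by gcongr
      _ = (2 * π * Real.exp A) * (g ^ k * Real.exp (-g)) := by ring
      _ ≤ (2 * π * Real.exp A) * ((k + 2).factorial * (1 + u ^ 2)⁻¹) := by gcongr
      _ = _ := by ring

lemma norm_w_le (c u : ℝ) (A : ℝ) (h : |c| ≤ A) : ‖(c : ℂ) + Complex.I * u‖ ≤ A + |u| := by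
  refine (norm_add_le _ _).trans ?_
  simp
  exact h

lemma norm_exp_w (c u t : ℝ) : ‖Complex.exp (t * ((c : ℂ) + Complex.I * u))‖ = Real.exp (t * c) := by
  rw [Complex.norm_exp]; simp

lemma w_int (c t : ℝ) (k : ℕ) : Integrable (fun u : ℝ =>
    ((c : ℂ) + Complex.I * u) ^ k * Complex.exp (t * ((c : ℂ) + Complex.I * u)) * (rho u : ℂ)) := by
  refine ((abs_int (1 + |c|) (by linarith [abs_nonneg c]) k).const_mul (Real.exp (t * c))).mono' ?_ ?_
  · have := rho_cont
    exact Continuous.aestronglyMeasurable (by fun_prop)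
  · refine Filter.Eventually.of_forall fun u => ?_
    rw [norm_mul, norm_mul, norm_pow, norm_exp_w, Complex.norm_real,
      Real.norm_of_nonneg (rho_nonneg u)]
    have := norm_w_le c u (1 + |c|) (by linarith)
    have := rho_nonneg u
    calc _ ≤ (1 + |c| + |u|) ^ k * Real.exp (t * c) * rho u := by gcongr
      _ = _ := by ring

noncomputable def FF (c : ℝ) (k : ℕ) (t : ℝ) : ℂ := ∫ u : ℝ,
    ((c : ℂ) + Complex.I * u) ^ k * Complex.exp (t * ((c : ℂ) + Complex.I * u)) * (rho u : ℂ)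

lemma FF_deriv (c : ℝ) (k : ℕ) (t : ℝ) : HasDerivAt (FF c k) (FF c (k + 1) t) t := by
  unfold FF
  refine (hasDerivAt_integral_of_dominated_loc_of_deriv_le (𝕜 := ℝ)
    (F := fun (t : ℝ) (u : ℝ) => ((c : ℂ) + Complex.I * u) ^ k *
      Complex.exp (t * ((c : ℂ) + Complex.I * u)) * (rho u : ℂ))
    (F' := fun (t : ℝ) (u : ℝ) => ((c : ℂ) + Complex.I * u) ^ (k + 1) *
      Complex.exp (t * ((c : ℂ) + Complex.I * u)) * (rho u : ℂ))
    (bound := fun u => Real.exp ((|t| + 1) * |c|) * ((1 + |c| + |u|) ^ (k + 1) * rho u))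
    (Metric.ball_mem_nhds t one_pos) ?_ (w_int c t k)
    (w_int c t (k + 1)).aestronglyMeasurable ?_ ?_ ?_).2
  · exact Filter.Eventually.of_forall fun s => (w_int c s k).aestronglyMeasurable
  · refine Filter.Eventually.of_forall fun u s hs => ?_
    rw [norm_mul, norm_mul, norm_pow, norm_exp_w, Complex.norm_real,
      Real.norm_of_nonneg (rho_nonneg u)]
    have := norm_w_le c u (1 + |c|) (by linarith)
    have := rho_nonneg u
    have h1 : s * c ≤ (|t| + 1) * |c| := by
      refine (le_abs_self _).trans ?_
      rw [abs_mul]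
      gcongr
      rw [Metric.mem_ball, Real.dist_eq] at hs
      have := abs_sub_abs_le_abs_sub s t
      linarith
    calc _ ≤ (1 + |c| + |u|) ^ (k + 1) * Real.exp ((|t| + 1) * |c|) * rho u := by gcongr
      _ = _ := by ring
  · exact (abs_int (1 + |c|) (by linarith [abs_nonneg c]) (k + 1)).const_mul _
  · refine Filter.Eventually.of_forall fun u s hs => ?_
    have h1 : HasDerivAt (fun s : ℝ => (s : ℂ) * ((c : ℂ) + Complex.I * u))
        (1 * ((c : ℂ) + Complex.I * u)) s :=
      (Complex.ofRealCLM.hasDerivAt (x := s)).mul_const _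
    have h2 := ((h1.cexp).const_mul (((c : ℂ) + Complex.I * u) ^ k)).mul_const (rho u : ℂ)
    exact h2.congr_deriv (by ring)

lemma rho_sig (u : ℝ) : rho u = 2 * π * (Real.sigmoid (2 * π * u) * (1 - Real.sigmoid (2 * π * u))) := by
  rw [← Real.sigmoid_neg, Real.sigmoid_def, Real.sigmoid_def, rho, Real.cosh_eq]
  have e1 : Real.exp (2 * π * u) = Real.exp (π * u) ^ 2 := by
    rw [← Real.exp_nat_mul]; congr 1; push_cast; ring
  rw [neg_neg, Real.exp_neg (2 * π * u), Real.exp_neg, e1]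
  have := Real.exp_pos (π * u)
  field_simp
  ring

lemma charf (t : ℝ) : ∫ u : ℝ, Complex.exp (t * (Complex.I * u)) * (rho u : ℂ) =
    Complex.betaIntegral (1 + Complex.I * t / (2 * π)) (1 - Complex.I * t / (2 * π)) := by
  rw [Complex.betaIntegral, intervalIntegral.integral_of_le zero_le_one,
    integral_Ioc_eq_integral_Ioo]
  have him : (fun u : ℝ => Real.sigmoid (2 * π * u)) '' Set.univ = Set.Ioo 0 1 := by
    rw [Set.image_univ, ← Real.range_sigmoid]
    exact (Function.Surjective.range_comp (f := fun u : ℝ => 2 * π * u)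
      (fun y => ⟨y / (2 * π), by field_simp⟩) Real.sigmoid)
  rw [← him, integral_image_eq_integral_abs_deriv_smul (f' := rho) MeasurableSet.univ]
  · rw [Measure.restrict_univ]
    refine integral_congr_ae (Filter.Eventually.of_forall fun u => ?_)
    simp only
    rw [abs_of_nonneg (rho_nonneg u), Complex.real_smul, mul_comm]
    congr 1
    set y := 2 * π * u with hy
    have p1 := Real.sigmoid_pos y
    have p2 : 0 < 1 - Real.sigmoid y := by linarith [Real.sigmoid_lt_one y]
    have hlog : Real.log (Real.sigmoid y) - Real.log (1 - Real.sigmoid y) = y := by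
      rw [← Real.sigmoid_neg, ← Real.sigmoid_mul_rexp_neg, Real.log_mul p1.ne' (Real.exp_pos _).ne',
        Real.log_exp]
      ring
    have e : (1 : ℂ) - (Real.sigmoid y : ℂ) = ((1 - Real.sigmoid y : ℝ) : ℂ) := by push_cast; ring
    rw [e, Complex.cpow_def_of_ne_zero (by exact_mod_cast p1.ne'),
      Complex.cpow_def_of_ne_zero (by exact_mod_cast p2.ne'), ← Complex.exp_add,
      ← Complex.ofReal_log p1.le, ← Complex.ofReal_log p2.le]
    congr 1
    have h2 : (Real.log (Real.sigmoid y) : ℂ) = (Real.log (1 - Real.sigmoid y) : ℂ) + 2 * π * u := by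
      rw [hy] at hlog ⊢
      have : Real.log (Real.sigmoid (2 * π * u)) = Real.log (1 - Real.sigmoid (2 * π * u)) + 2 * π * u := by
        linarith
      rw [this]; push_cast; ring
    rw [h2]
    have : (π : ℂ) ≠ 0 := by exact_mod_cast Real.pi_ne_zero
    field_simp
    ring
  · intro u _
    have h := (Real.hasDerivAt_sigmoid (2 * π * u)).comp u ((hasDerivAt_id u).const_mul (2 * π))
    refine HasDerivAt.hasDerivWithinAt ?_
    exact h.congr_deriv (by rw [rho_sig]; ring)
  · intro a _ b _ hab
    have := Real.sigmoid_injective hab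
    have hp := Real.pi_pos
    exact mul_left_cancel₀ (by positivity) this

lemma charf_mul (t : ℝ) : (∫ u : ℝ, Complex.exp (t * (Complex.I * u)) * (rho u : ℂ)) *
    (Complex.exp (t / 2) - Complex.exp (-(t / 2))) = t := by
  by_cases ht : t = 0
  · simp [ht]
  have hp : (π : ℂ) ≠ 0 := by exact_mod_cast Real.pi_ne_zero
  have htc : (t : ℂ) ≠ 0 := by exact_mod_cast ht
  set a : ℂ := Complex.I * t / (2 * π) with ha
  have hre : a.re = 0 := by
    have : a = Complex.I * ((t / (2 * π) : ℝ) : ℂ) := by rw [ha]; push_cast; ring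
    rw [this, Complex.I_mul_re, Complex.ofReal_im, neg_zero]
  have ha0 : a ≠ 0 := by rw [ha]; simp [hp, htc]
  have hb := Complex.Gamma_mul_Gamma_eq_betaIntegral (s := 1 + a) (t := 1 - a)
    (by simp [hre]) (by simp [hre])
  have h2 : (1 + a) + (1 - a) = 1 + 1 := by ring
  rw [h2, Complex.Gamma_add_one 1 one_ne_zero, Complex.Gamma_one, one_mul, one_mul, add_comm 1 a,
    Complex.Gamma_add_one a ha0, mul_assoc, Complex.Gamma_mul_Gamma_one_sub] at hb
  rw [charf, ← ha, add_comm 1 a, ← hb]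
  have h3 : π * a = (t / 2 : ℂ) * Complex.I := by rw [ha]; field_simp
  rw [h3, Complex.sin_mul_I]
  have h4 : Complex.exp (t / 2) - Complex.exp (-(t / 2)) = 2 * Complex.sinh (t / 2) := by
    rw [Complex.two_sinh]
  have h5 : Complex.sinh (t / 2) ≠ 0 := by
    have : Complex.sinh (t / 2) = ((Real.sinh (t / 2) : ℝ) : ℂ) := by push_cast; rfl
    rw [this]
    exact_mod_cast (Real.sinh_ne_zero.mpr (by positivity))
  rw [h4, ha]
  field_simp

lemma FF_zero (c t : ℝ) : FF c 0 t = Complex.exp (t * c) *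
    ∫ u : ℝ, Complex.exp (t * (Complex.I * u)) * (rho u : ℂ) := by
  rw [FF, ← integral_const_mul]
  congr 1; ext u
  rw [mul_add, Complex.exp_add]; ring

lemma FF_diff (x : ℝ) (k : ℕ) (t : ℝ) : FF (x + 1 / 2) k t - FF (x - 1 / 2) k t =
    Complex.exp (t * x) * (t * x ^ k + k * x ^ (k - 1)) := by
  induction k generalizing t with
  | zero =>
    rw [FF_zero, FF_zero, ← sub_mul]
    have h := charf_mul t
    have e1 : Complex.exp (t * ((x + 1 / 2 : ℝ) : ℂ)) = Complex.exp (t * x) * Complex.exp (t / 2) := by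
      rw [← Complex.exp_add]; congr 1; push_cast; ring
    have e2 : Complex.exp (t * ((x - 1 / 2 : ℝ) : ℂ)) = Complex.exp (t * x) * Complex.exp (-(t / 2)) := by
      rw [← Complex.exp_add]; congr 1; push_cast; ring
    rw [e1, e2, ← mul_sub, mul_assoc, mul_comm (_ - _), h]
    simp
  | succ k ih =>
    have h1 := (FF_deriv (x + 1 / 2) k t).sub (FF_deriv (x - 1 / 2) k t)
    have hid : HasDerivAt (fun s : ℝ => (s : ℂ)) 1 t := Complex.ofRealCLM.hasDerivAt (x := t)
    have h2 := ((hid.mul_const (x : ℂ)).cexp).mul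
      ((hid.mul_const ((x : ℂ) ^ k)).add_const ((k : ℂ) * x ^ (k - 1)))
    have h3 : (FF (x + 1 / 2) k - FF (x - 1 / 2) k) = fun t : ℝ =>
      Complex.exp (t * x) * (t * x ^ k + k * x ^ (k - 1)) := funext ih
    rw [h3] at h1
    rw [h1.unique h2]
    cases k with
    | zero => simp; ring
    | succ k => simp; ring

lemma inner_v (w : ℂ) (n : ℕ) : ∫ v in (0 : ℝ)..1, (w + (v : ℂ)) ^ n =
    ((w + 1) ^ (n + 1) - w ^ (n + 1)) / (n + 1) := by
  have hn : (n : ℂ) + 1 ≠ 0 := by exact_mod_cast n.succ_ne_zero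
  rw [intervalIntegral.integral_eq_sub_of_hasDerivAt
    (f := fun v : ℝ => (w + (v : ℂ)) ^ (n + 1) / (n + 1))]
  · simp; ring
  · intro v _
    have hid : HasDerivAt (fun s : ℝ => (s : ℂ)) 1 v := Complex.ofRealCLM.hasDerivAt (x := v)
    have h := ((hid.const_add w).pow (n + 1)).div_const ((n : ℂ) + 1)
    refine h.congr_deriv ?_
    push_cast
    field_simp
  · exact Continuous.intervalIntegrable (by fun_prop) _ _

lemma w_int' (c : ℝ) (k : ℕ) : Integrable (fun u : ℝ =>
    ((c : ℂ) + Complex.I * u) ^ k * (rho u : ℂ)) := by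
  simpa using w_int c 0 k

lemma main_aux (n : ℕ) (x : ℝ) :
    (∀ v : ℝ, Integrable (fun u : ℝ =>
      ((x : ℂ) - 1 / 2 + Complex.I * (u : ℂ) + (v : ℂ)) ^ n * (rho u : ℂ))) ∧
    (∫ v in (0 : ℝ)..1, ∫ u : ℝ,
        ((x : ℂ) - 1 / 2 + Complex.I * (u : ℂ) + (v : ℂ)) ^ n * (rho u : ℂ)) = (x : ℂ) ^ n := by
  have hn : (n : ℂ) + 1 ≠ 0 := by exact_mod_cast n.succ_ne_zero
  refine ⟨fun v => ?_, ?_⟩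
  · refine (w_int' (x - 1 / 2 + v) n).congr (Filter.Eventually.of_forall fun u => ?_)
    have e1 : (x : ℂ) - 1 / 2 + Complex.I * u + v = ((x - 1 / 2 + v : ℝ) : ℂ) + Complex.I * u := by
      push_cast; ring
    simp only [e1]
  rw [intervalIntegral_integral_swap]
  · simp_rw [intervalIntegral.integral_mul_const, inner_v]
    have h := FF_diff x (n + 1) 0
    have e : ∀ u : ℝ, (((x : ℂ) - 1 / 2 + Complex.I * u + 1) ^ (n + 1) -
        ((x : ℂ) - 1 / 2 + Complex.I * u) ^ (n + 1)) / (n + 1) * (rho u : ℂ) =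
        (1 / ((n : ℂ) + 1)) * ((((x + 1 / 2 : ℝ) : ℂ) + Complex.I * u) ^ (n + 1) * (rho u : ℂ) -
        (((x - 1 / 2 : ℝ) : ℂ) + Complex.I * u) ^ (n + 1) * (rho u : ℂ)) := by
      intro u
      have e1 : (x : ℂ) - 1 / 2 + Complex.I * u + 1 = ((x + 1 / 2 : ℝ) : ℂ) + Complex.I * u := by
        push_cast; ring
      have e2 : (x : ℂ) - 1 / 2 + Complex.I * u = ((x - 1 / 2 : ℝ) : ℂ) + Complex.I * u := by
        push_cast; ring
      rw [e1, e2]; ring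
    simp_rw [e]
    rw [integral_const_mul, integral_sub (w_int' _ _) (w_int' _ _)]
    simp only [FF, Complex.ofReal_zero, zero_mul, Complex.exp_zero, mul_one, zero_add, one_mul,
      Nat.add_sub_cancel] at h
    rw [h]
    push_cast
    field_simp
  · have hb := (abs_int (|x| + 2) (by linarith [abs_nonneg x]) n)
    rw [Set.uIoc_of_le zero_le_one]
    have h1 : Integrable (fun _ : ℝ => (1 : ℝ)) (volume.restrict (Set.Ioc (0 : ℝ) 1)) :=
      integrable_const _
    refine (h1.mul_prod hb).mono' ?_ ?_
    · have := rho_cont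
      refine Continuous.aestronglyMeasurable ?_
      simp only [Function.uncurry_def]
      fun_prop
    · have hmem : ∀ᵐ p : ℝ × ℝ ∂((volume.restrict (Set.Ioc (0 : ℝ) 1)).prod volume),
          p.1 ∈ Set.Ioc (0 : ℝ) 1 :=
        Measure.quasiMeasurePreserving_fst.ae (ae_restrict_mem measurableSet_Ioc)
      filter_upwards [hmem] with p hp
      obtain ⟨v, u⟩ := p
      simp only [Function.uncurry, one_mul] at hp ⊢
      rw [norm_mul, norm_pow, Complex.norm_real, Real.norm_of_nonneg (rho_nonneg u)]
      have h2 : |x - 1 / 2 + v| ≤ |x| + 2 := by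
        have := le_abs_self x
        have := neg_abs_le x
        rw [abs_le]; constructor <;> linarith [hp.1, hp.2]
      have h3 := norm_w_le (x - 1 / 2 + v) u _ h2
      have e1 : (x : ℂ) - 1 / 2 + Complex.I * u + v = ((x - 1 / 2 + v : ℝ) : ℂ) + Complex.I * u := by
        push_cast; ring
      rw [e1]
      have := rho_nonneg u
      gcongr

/-- Cancellation lemma, Bernoulli case:
`∫₀¹ ∫_ℝ (x - 1/2 + i u + v)^n (π/2) sech²(π u) du dv = xⁿ`. -/
theorem statement_4 (n : ℕ) (x : ℝ) :
    (∀ v : ℝ, Integrable (fun u : ℝ =>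
      ((x : ℂ) - 1 / 2 + Complex.I * (u : ℂ) + (v : ℂ)) ^ n *
        (((π / 2) * (1 / Real.cosh (π * u)) ^ 2 : ℝ) : ℂ))) ∧
    (∫ v in (0 : ℝ)..1, ∫ u : ℝ,
        ((x : ℂ) - 1 / 2 + Complex.I * (u : ℂ) + (v : ℂ)) ^ n *
          (((π / 2) * (1 / Real.cosh (π * u)) ^ 2 : ℝ) : ℂ)) = (x : ℂ) ^ n := by
  exact main_aux n x
end
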